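/- Let F be a subfield of ℂ, let V be a finite-dimensional F-vector space, let T : V → V be an F-linear endomorphism whose characteristic polynomial is irreducible over F, and let λ ∈ ℂ be an eigenvalue of the base-changed endomorphism T ⊗ idℂ on V ⊗_F ℂ. Then for every proper F-subspace W of V, the eigenspace of T ⊗ idℂ for λ intersects the image of W ⊗_F ℂ in V ⊗_F ℂ only in 0. (Contrapositive form of the paper's Lemma 2.1: if the Hecke polynomial is irreducible over F, no proper F-rational subspace of the space of cusp forms contains an eigenform.) -/

import Mathlib

open Polynomial in
/-- If the characteristic polynomial of `T` is irreducible, every nonzero functional is a cyclic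
vector for the transpose of `T`. -/
theorem LinearMap.exists_comp_aeval_eq_of_charpoly_irreducible
    {F V : Type*} [Field F] [AddCommGroup V] [Module F V] [FiniteDimensional F V]
    {T : V →ₗ[F] V} (hirr : Irreducible T.charpoly) {φ : Module.Dual F V} (hφ : φ ≠ 0)
    (ψ : Module.Dual F V) : ∃ p : F[X], φ ∘ₗ aeval T p = ψ := by
  let L : F[X] →ₗ[F] Module.Dual F V :=
    (LinearMap.llcomp F V V F φ) ∘ₗ (aeval T : F[X] →ₐ[F] Module.End F V).toLinearMap
  have hker : ∀ p, L p = 0 → T.charpoly ∣ p := by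
    intro p hp
    by_contra hdvd
    obtain ⟨a, b, hab⟩ := (hirr.coprime_iff_not_dvd).2 hdvd
    apply hφ
    have h := congrArg (aeval T) hab
    rw [map_add, map_mul, LinearMap.aeval_self_charpoly, mul_zero, zero_add, mul_comm b p,
      map_mul, map_one] at h
    calc φ = φ ∘ₗ (aeval T p * aeval T b) := by rw [h]; rfl
      _ = (L p) ∘ₗ aeval T b := rfl
      _ = 0 := by rw [hp, LinearMap.zero_comp]
  let L' := L.domRestrict (degreeLT F (Module.finrank F V))
  have hinj : Function.Injective L' := by
    rw [← LinearMap.ker_eq_bot, LinearMap.ker_eq_bot']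
    rintro ⟨p, hp⟩ h
    have hd := hker p h
    ext1
    refine eq_zero_of_dvd_of_degree_lt hd ?_
    rw [degree_eq_natDegree T.charpoly_monic.ne_zero, T.charpoly_natDegree]
    exact mem_degreeLT.1 hp
  have : FiniteDimensional F (degreeLT F (Module.finrank F V)) :=
    (degreeLTEquiv F _).symm.finiteDimensional
  have hrank : Module.finrank F (degreeLT F (Module.finrank F V)) =
      Module.finrank F (Module.Dual F V) := by
    rw [(degreeLTEquiv F _).finrank_eq, Subspace.dual_finrank_eq, Module.finrank_fin_fun]
  obtain ⟨p, hp⟩ := (LinearMap.injective_iff_surjective_of_finrank_eq_finrank hrank).1 hinj ψ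
  exact ⟨p, hp⟩

open Polynomial in
/-- A base-changed polynomial in `T` acts on an eigenvector through its value at the eigenvalue. -/
theorem LinearMap.baseChange_aeval_apply_of_eigenvector
    {F A V : Type*} [CommRing F] [CommRing A] [Algebra F A] [AddCommGroup V] [Module F V]
    {T : V →ₗ[F] V} {a : A} {v : TensorProduct F A V} (hv : T.baseChange A v = a • v)
    (p : F[X]) : (aeval T p : V →ₗ[F] V).baseChange A v = aeval a p • v := by
  induction p using Polynomial.induction_on' with
  | add p q hp hq =>
    rw [map_add, LinearMap.baseChange_add, LinearMap.add_apply, hp, hq, map_add, add_smul]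
  | monomial n c =>
    have hpow : (T ^ n).baseChange A v = a ^ n • v := by
      induction n with
      | zero => simp [Module.End.one_eq_id]
      | succ n ih =>
        rw [pow_succ, Module.End.mul_eq_comp, LinearMap.baseChange_comp, LinearMap.comp_apply,
          hv, map_smul, ih, smul_smul, pow_succ']
    rw [aeval_monomial, aeval_monomial, ← Algebra.smul_def, ← Algebra.smul_def,
      LinearMap.baseChange_smul, LinearMap.smul_apply, hpow, smul_assoc]

/-- A vector of the base change killed by all base-changed functionals is zero. -/
theorem Module.eq_zero_of_forall_dual_baseChange_apply_eq_zero
    {F A V : Type*} [CommRing F] [CommRing A] [Algebra F A] [AddCommGroup V] [Module F V]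
    [Module.Free F V] {v : TensorProduct F A V}
    (h : ∀ ψ : Module.Dual F V, LinearMap.baseChange A ψ v = 0) : v = 0 := by
  let b := Module.Free.chooseBasis F V
  have key : ∀ i, ∀ w : TensorProduct F A V, (b.baseChange A).repr w i =
      TensorProduct.rid F A (LinearMap.baseChange A (b.coord i) w) := by
    intro i w
    induction w using TensorProduct.induction_on with
    | zero => simp
    | tmul x y => simp
    | add x y hx hy => simp only [map_add, Finsupp.add_apply, hx, hy]
  refine (b.baseChange A).ext_elem fun i => ?_
  rw [key, h, map_zero, map_zero, Finsupp.zero_apply]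

/-- If the characteristic polynomial of `T` is irreducible over a subfield `F` of `ℂ`
and `lam` is an eigenvalue of the base-changed endomorphism `T ⊗ idℂ`, then for every
proper `F`-subspace `W` of `V`, the `lam`-eigenspace of `T ⊗ idℂ` meets the image of
`W ⊗_F ℂ` only in `0`. -/
theorem eigenvector_not_in_proper_subspace_of_charpoly_irreducible
    (F : Subfield ℂ) (V : Type*) [AddCommGroup V] [Module F V] [FiniteDimensional F V]
    (T : V →ₗ[F] V) (hirr : Irreducible (LinearMap.charpoly T))
    (lam : ℂ) (hlam : Module.End.HasEigenvalue (LinearMap.baseChange ℂ T) lam) :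
    ∀ W : Submodule F V, W ≠ ⊤ →
      ∀ v ∈ Submodule.baseChange ℂ W, LinearMap.baseChange ℂ T v = lam • v → v = 0 := by
  intro W hW v hvW hv
  obtain ⟨φ, hφ, hφW⟩ := W.exists_le_ker_of_lt_top hW.lt_top
  have hφv : LinearMap.baseChange ℂ φ v = 0 := by
    have hle : Submodule.baseChange ℂ W ≤ LinearMap.ker (LinearMap.baseChange ℂ φ) := by
      rw [Submodule.baseChange_eq_span, Submodule.span_le]
      rintro _ ⟨w, hw, rfl⟩
      have : φ w = 0 := hφW hw
      simp [this]
    exact hle hvW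
  refine Module.eq_zero_of_forall_dual_baseChange_apply_eq_zero fun ψ => ?_
  obtain ⟨p, rfl⟩ := LinearMap.exists_comp_aeval_eq_of_charpoly_irreducible hirr hφ ψ
  rw [LinearMap.baseChange_comp, LinearMap.comp_apply,
    LinearMap.baseChange_aeval_apply_of_eigenvector hv, map_smul, hφv, smul_zero]
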